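/- arXiv:2405.11588 — 3 statements merged into one kernel-verified Lean document; each statement's English description precedes it below -/
import Mathlib

section
/- Let λ be a nonzero real number and let d, w₀ : ℝ → ℝ be continuously differentiable. Define w : ℝ × ℝ → ℝ by w(t,x) = w₀(x − λt) · exp(−sgn(λ) · ∫_{x−λt}^{x} d(z) dz). Then for every (t,x) ∈ ℝ² the partial derivatives ∂_t w(t,x) and ∂_x w(t,x) exist and satisfy ∂_t w(t,x) + λ ∂_x w(t,x) = −d(x) · |λ| · w(t,x). -/
/-- The explicit formula `w(t,x) = w₀(x-λt) exp(-sgn(λ) ∫_{x-λt}^x d)` solves the damped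
transport equation `∂ₜw + λ ∂ₓw = -d(x)|λ| w`. -/
theorem stmt_1 (l : ℝ) (hl : l ≠ 0) (d w₀ : ℝ → ℝ)
    (hd : ContDiff ℝ 1 d) (hw₀ : ContDiff ℝ 1 w₀)
    (w : ℝ → ℝ → ℝ)
    (hw : ∀ t x : ℝ, w t x =
        w₀ (x - l * t) * Real.exp (-Real.sign l * ∫ z in (x - l * t)..x, d z)) :
    ∀ t x : ℝ, ∃ wt wx : ℝ,
      HasDerivAt (fun τ => w τ x) wt t ∧
      HasDerivAt (fun y => w t y) wx x ∧
      wt + l * wx = -(d x) * |l| * w t x := by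
  intro t x
  have hdc : Continuous d := hd.continuous
  set F : ℝ → ℝ := fun y => ∫ z in (0 : ℝ)..y, d z with hF
  have hF' : ∀ y, HasDerivAt F (d y) y := fun y => hdc.integral_hasStrictDerivAt 0 y |>.hasDerivAt
  have hint : ∀ a b, ∫ z in a..b, d z = F b - F a := fun a b =>
    (intervalIntegral.integral_interval_sub_left (hdc.intervalIntegrable _ _)
      (hdc.intervalIntegrable _ _)).symm
  have hw₀' : ∀ y, HasDerivAt w₀ (deriv w₀ y) y := fun y =>
    (hw₀.differentiable one_ne_zero y).hasDerivAt
  have hsign : Real.sign l * l = |l| := by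
    rcases lt_or_gt_of_ne hl with h | h
    · rw [Real.sign_of_neg h, abs_of_neg h]; ring
    · rw [Real.sign_of_pos h, abs_of_pos h]; ring
  simp only [hw, hint]
  have ht : HasDerivAt (fun τ : ℝ => x - l * τ) (-l) t := by
    simpa using ((hasDerivAt_id t).const_mul l).const_sub x
  have hx : HasDerivAt (fun y : ℝ => y - l * t) 1 x := (hasDerivAt_id x).sub_const (l * t)
  refine ⟨_, _,
    ((hw₀' (x - l * t)).comp t ht).mul
      ((((hF' (x - l * t)).comp t ht).const_sub (F x)).const_mul (-Real.sign l)).exp,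
    ((hw₀' (x - l * t)).comp x hx).mul
      (((hF' x).sub ((hF' (x - l * t)).comp x hx)).const_mul (-Real.sign l)).exp, ?_⟩
  rw [← hsign]
  simp only [Function.comp_apply, Pi.sub_apply]
  ring
end

section
/- Let n ≥ 1, let H be a real symmetric positive definite n × n matrix (xᵀHx > 0 for all x ≠ 0), let R be an invertible real n × n matrix such that Rᵀ·H·R is diagonal, and let D be a real diagonal n × n matrix all of whose diagonal entries are ≤ 0. Then for every x ∈ ℝⁿ, xᵀ·(H·R·D·R⁻¹)·x ≤ 0; that is, H·R·D·R⁻¹ is negative semidefinite. -/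
open Matrix in
/-- A congruence transform `Rᵀ H R` of a matrix with nonnegative quadratic form has nonnegative
diagonal entries. -/
theorem Matrix.transpose_mul_mul_diag_nonneg {m : Type*} [Fintype m] [DecidableEq m]
    {H : Matrix m m ℝ} (hH : ∀ x : m → ℝ, 0 ≤ x ⬝ᵥ H *ᵥ x) (R : Matrix m m ℝ) (i : m) :
    0 ≤ (Rᵀ * H * R) i i := by
  have h := hH (R *ᵥ Pi.single i 1)
  have e : (R *ᵥ Pi.single i 1) ⬝ᵥ H *ᵥ (R *ᵥ Pi.single i 1)
      = Pi.single i 1 ⬝ᵥ (Rᵀ * H * R) *ᵥ Pi.single i 1 := by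
    rw [← mulVec_mulVec, ← mulVec_mulVec, dotProduct_mulVec _ Rᵀ, vecMul_transpose]
  rw [e] at h
  simpa using h

open Matrix in
/-- If `H` is symmetric positive definite, `Rᵀ H R` is diagonal with `R` invertible, and
`D` is diagonal with nonpositive entries, then `H R D R⁻¹` is negative semidefinite. -/
theorem stmt_11 (n : ℕ) (hn : 1 ≤ n) (H R D : Matrix (Fin n) (Fin n) ℝ)
    (hH : H.IsSymm) (hHpos : ∀ x : Fin n → ℝ, x ≠ 0 → 0 < x ⬝ᵥ H.mulVec x)
    (hR : IsUnit R) (hRHR : (Rᵀ * H * R).IsDiag)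
    (hD : D.IsDiag) (hDneg : ∀ i : Fin n, D i i ≤ 0) :
    ∀ x : Fin n → ℝ, x ⬝ᵥ (H * R * D * R⁻¹).mulVec x ≤ 0 := by
  intro x
  have hnonneg : ∀ z : Fin n → ℝ, 0 ≤ z ⬝ᵥ H *ᵥ z := by
    intro z
    rcases eq_or_ne z 0 with rfl | hz
    · simp
    · exact (hHpos z hz).le
  have hdet : IsUnit R.det := (isUnit_iff_isUnit_det R).mp hR
  obtain ⟨y, rfl⟩ : ∃ y, x = R *ᵥ y :=
    ⟨R⁻¹ *ᵥ x, by rw [mulVec_mulVec, mul_nonsing_inv R hdet, one_mulVec]⟩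
  have key : (R *ᵥ y) ⬝ᵥ (H * R * D * R⁻¹) *ᵥ (R *ᵥ y)
      = y ⬝ᵥ ((Rᵀ * H * R) * D) *ᵥ y := by
    rw [mulVec_mulVec, Matrix.mul_assoc _ R⁻¹, nonsing_inv_mul R hdet, Matrix.mul_one,
      ← vecMul_transpose, ← dotProduct_mulVec, mulVec_mulVec]
    simp only [Matrix.mul_assoc]
  rw [key, ← hRHR.diagonal_diag, ← hD.diagonal_diag, diagonal_mul_diagonal]
  refine Finset.sum_nonpos fun i _ => ?_
  rw [mulVec_diagonal]
  have hi := mul_nonpos_of_nonneg_of_nonpos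
    (transpose_mul_mul_diag_nonneg hnonneg R i) (hDneg i)
  simp only [diag_apply]
  nlinarith [mul_nonpos_of_nonneg_of_nonpos (mul_self_nonneg (y i)) hi]
end

section
/- Let n ≥ 1. Let H be a real symmetric positive definite n × n matrix, let S : ℝ → (real n × n matrices) be continuously differentiable with H·S(x) symmetric for every x and with vᵀ·(H·S′(x))·v ≤ 0 for every x ∈ ℝ and v ∈ ℝⁿ. Let q : ℝ × ℝ → ℝⁿ be continuously differentiable, suppose there is a compact set K ⊆ ℝ such that q(t,x) = 0 for all t and all x ∉ K, and suppose ∂_t q(t,x) + S(x)·∂_x q(t,x) = 0 for all (t,x). Then the entropy functional t ↦ ∫_ℝ ½ ⟨q(t,x), H·q(t,x)⟩ dx is nonincreasing in t. -/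
open MeasureTheory in
/-- Differentiation under the integral sign for integrands supported in a fixed compact set. -/
theorem hasDerivAt_integral_of_continuous_of_compact_support {F F' : ℝ → ℝ → ℝ} {K : Set ℝ}
    (hK : IsCompact K) (hF : Continuous fun p : ℝ × ℝ => F p.1 p.2)
    (hF' : Continuous fun p : ℝ × ℝ => F' p.1 p.2) (hF0 : ∀ t, ∀ x ∉ K, F t x = 0)
    (hF'0 : ∀ t, ∀ x ∉ K, F' t x = 0) (hd : ∀ t x, HasDerivAt (fun s => F s x) (F' t x) t)
    (t : ℝ) : HasDerivAt (fun s => ∫ x, F s x) (∫ x, F' t x) t := by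
  have hFt (s : ℝ) : Continuous (F s) := hF.comp (Continuous.prodMk_right s)
  have hFt' (s : ℝ) : Continuous (F' s) := hF'.comp (Continuous.prodMk_right s)
  obtain ⟨C, hC⟩ := ((isCompact_Icc (a := t - 1) (b := t + 1)).prod hK).exists_bound_of_continuousOn
    hF'.continuousOn
  refine (hasDerivAt_integral_of_dominated_loc_of_deriv_le (bound := K.indicator fun _ => C)
    (Icc_mem_nhds (sub_one_lt t) (lt_add_one t))
    (.of_forall fun s => (hFt s).aestronglyMeasurable)
    ((hFt t).integrable_of_hasCompactSupport (HasCompactSupport.intro hK (hF0 t)))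
    (hFt' t).aestronglyMeasurable (.of_forall fun x s hs => ?_) ?_
    (.of_forall fun x s _ => hd s x)).2
  · by_cases hx : x ∈ K
    · simpa [hx] using hC (s, x) ⟨hs, hx⟩
    · simp [hx, hF'0 s x hx]
  · exact (integrable_indicator_iff hK.measurableSet).2 (integrableOn_const hK.measure_ne_top)

/-- Product rule for a quadratic form with variable coefficients. -/
theorem HasDerivAt.dotProduct_mulVec_self {ι : Type*} [Fintype ι] {M : ℝ → Matrix ι ι ℝ}
    {M' : Matrix ι ι ℝ} {u : ℝ → ι → ℝ} {u' : ι → ℝ} {x : ℝ}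
    (hM : ∀ i j, HasDerivAt (fun y => M y i j) (M' i j) x) (hu : HasDerivAt u u' x) :
    HasDerivAt (fun y => u y ⬝ᵥ (M y).mulVec (u y))
      (u' ⬝ᵥ (M x).mulVec (u x) + u x ⬝ᵥ M'.mulVec (u x) + u x ⬝ᵥ (M x).mulVec u') x := by
  have hu' := hasDerivAt_pi.1 hu
  refine (HasDerivAt.fun_sum fun i (_ : i ∈ Finset.univ) => (hu' i).mul <|
    HasDerivAt.fun_sum fun j (_ : j ∈ Finset.univ) => (hM i j).mul (hu' j)).congr_deriv ?_
  simp only [dotProduct, Matrix.mulVec, Pi.mul_apply, Finset.sum_add_distrib, mul_add, add_assoc]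

theorem Matrix.IsSymm.dotProduct_mulVec_comm {ι : Type*} [Fintype ι] {M : Matrix ι ι ℝ}
    (hM : M.IsSymm) (u v : ι → ℝ) : u ⬝ᵥ M.mulVec v = v ⬝ᵥ M.mulVec u := by
  rw [Matrix.dotProduct_mulVec, ← Matrix.mulVec_transpose, hM.eq, dotProduct_comm]

open Matrix in
/-- Entropy stability of the slowing-down operator: if `H` is a symmetric positive definite
symmetrizer, `H S(x)` is symmetric, `H S'(x)` is negative semidefinite, and `q` is a
compactly supported (in space) `C¹` solution of `∂ₜq + S(x) ∂ₓq = 0`, then the entropy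
`t ↦ ∫ ½ qᵀ H q dx` is nonincreasing. -/
theorem stmt_13 (n : ℕ) (hn : 1 ≤ n) (H : Matrix (Fin n) (Fin n) ℝ)
    (hHsymm : H.IsSymm) (hHpos : ∀ v : Fin n → ℝ, v ≠ 0 → 0 < v ⬝ᵥ H.mulVec v)
    (S S' : ℝ → Matrix (Fin n) (Fin n) ℝ)
    (hSderiv : ∀ x : ℝ, ∀ i j : Fin n, HasDerivAt (fun y => S y i j) (S' x i j) x)
    (hS'cont : ∀ i j : Fin n, Continuous fun x => S' x i j)
    (hHSsymm : ∀ x : ℝ, (H * S x).IsSymm)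
    (hHS'neg : ∀ x : ℝ, ∀ v : Fin n → ℝ, v ⬝ᵥ (H * S' x).mulVec v ≤ 0)
    (q qt qx : ℝ → ℝ → Fin n → ℝ)
    (hqC1 : ContDiff ℝ 1 (fun p : ℝ × ℝ => q p.1 p.2))
    (K : Set ℝ) (hK : IsCompact K) (hqsupp : ∀ t x : ℝ, x ∉ K → q t x = 0)
    (hqt : ∀ t x : ℝ, HasDerivAt (fun τ => q τ x) (qt t x) t)
    (hqx : ∀ t x : ℝ, HasDerivAt (fun y => q t y) (qx t x) x)
    (hPDE : ∀ t x : ℝ, qt t x + (S x).mulVec (qx t x) = 0) :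
    Antitone fun t : ℝ => ∫ x : ℝ, (1 / 2) * (q t x ⬝ᵥ H.mulVec (q t x)) := by
  have hQ : Continuous fun p : ℝ × ℝ => q p.1 p.2 := hqC1.continuous
  have hqt_cont : Continuous fun p : ℝ × ℝ => qt p.1 p.2 := by
    have hfd : Continuous fun p => fderiv ℝ (fun p : ℝ × ℝ => q p.1 p.2) p (1, 0) :=
      (hqC1.continuous_fderiv one_ne_zero).clm_apply continuous_const
    convert hfd using 2 with p
    exact (hqt p.1 p.2).unique <|
      ((hqC1.differentiable one_ne_zero) p).hasFDerivAt.comp_hasDerivAt_of_eq p.1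
        ((hasDerivAt_id p.1).prodMk (hasDerivAt_const p.1 p.2)) rfl
  have hS_cont : Continuous S := continuous_matrix fun i j =>
    continuous_iff_continuousAt.2 fun x => (hSderiv x i j).continuousAt
  have hS'_cont : Continuous S' := continuous_matrix hS'cont
  have hflux (t x : ℝ) : HasDerivAt (fun y => q t y ⬝ᵥ (H * S y).mulVec (q t y))
      (q t x ⬝ᵥ (H * S' x).mulVec (q t x) - 2 * (q t x ⬝ᵥ H.mulVec (qt t x))) x := by
    have hHS (i j : Fin n) : HasDerivAt (fun y => (H * S y) i j) ((H * S' x) i j) x := by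
      simp only [Matrix.mul_apply]
      exact HasDerivAt.fun_sum fun k _ => (hSderiv x k j).const_mul (H i k)
    refine (HasDerivAt.dotProduct_mulVec_self hHS (hqx t x)).congr_deriv ?_
    rw [(hHSsymm x).dotProduct_mulVec_comm (qx t x), ← Matrix.mulVec_mulVec (qx t x),
      eq_neg_of_add_eq_zero_left (hPDE t x), Matrix.mulVec_neg, dotProduct_neg]
    ring
  have hentropy (t : ℝ) := hasDerivAt_integral_of_continuous_of_compact_support
    (F := fun t x => (1 / 2) * (q t x ⬝ᵥ H.mulVec (q t x)))
    (F' := fun t x => q t x ⬝ᵥ H.mulVec (qt t x)) hK (by fun_prop) (by fun_prop)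
    (fun t x hx => by simp [hqsupp t x hx]) (fun t x hx => by simp [hqsupp t x hx])
    (fun t x => by
      refine ((HasDerivAt.dotProduct_mulVec_self (M := fun _ => H) (M' := 0)
        (fun i j => hasDerivAt_const t (H i j)) (hqt t x)).const_mul (1 / 2 : ℝ)).congr_deriv ?_
      rw [hHsymm.dotProduct_mulVec_comm (qt t x), Matrix.zero_mulVec, dotProduct_zero]
      ring) t
  refine antitone_of_deriv_nonpos (fun t => (hentropy t).differentiableAt) fun t => ?_
  rw [(hentropy t).deriv]
  have hqc : Continuous (q t) := hQ.comp (Continuous.prodMk_right t)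
  have hqtc : Continuous (qt t) := hqt_cont.comp (Continuous.prodMk_right t)
  have hintegrable {f : ℝ → ℝ} (hf : Continuous f) (hf0 : ∀ x, q t x = 0 → f x = 0) :
      MeasureTheory.Integrable f :=
    hf.integrable_of_hasCompactSupport
      (HasCompactSupport.intro hK fun x hx => hf0 x (hqsupp t x hx))
  have hsource_int : MeasureTheory.Integrable fun x => q t x ⬝ᵥ (H * S' x).mulVec (q t x) :=
    hintegrable (by fun_prop) fun x hx => by simp [hx]
  have hrate_int : MeasureTheory.Integrable fun x => 2 * (q t x ⬝ᵥ H.mulVec (qt t x)) :=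
    hintegrable (by fun_prop) fun x hx => by simp [hx]
  have hzero := MeasureTheory.integral_eq_zero_of_hasDerivAt_of_integrable (hflux t)
    (hsource_int.sub hrate_int) (hintegrable (by fun_prop) fun x hx => by simp [hx])
  rw [MeasureTheory.integral_sub hsource_int hrate_int,
    MeasureTheory.integral_const_mul] at hzero
  have hsource : ∫ x, q t x ⬝ᵥ (H * S' x).mulVec (q t x) ≤ 0 :=
    MeasureTheory.integral_nonpos fun x => hHS'neg x (q t x)
  linarith
end
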